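/- Let G be a finite group, set r = log |G|, let S be a nonempty subset of G, and let g be an element of the subgroup generated by S. Then there is an SLP over S of reduced length at most (r+1)² computing g. -/

import Mathlib

/-- `log₂ m` is the least natural number `r` with `2 ^ r ≥ m`. -/
noncomputable def log₂ (m : ℕ) : ℕ := sInf {r : ℕ | m ≤ 2 ^ r}

/-- A straight line program (SLP) over a subset `S` of a group `G` is a finite
sequence `y 0, …, y (n-1)` of elements of `G` in which each `y i` either lies
in `S`, or is the inverse of an earlier element, or the product of two earlier
elements. -/
def IsSLP {G : Type*} [Group G] (S : Set G) {n : ℕ} (y : Fin n → G) : Prop :=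
  ∀ i : Fin n, y i ∈ S ∨ (∃ j, j < i ∧ y i = (y j)⁻¹) ∨
    ∃ j k, j < i ∧ k < i ∧ y i = y j * y k

/-- The reduced length of an SLP is the number of indices `i` with `y i ∉ S`. -/
noncomputable def reducedLength {G : Type*} (S : Set G) {n : ℕ} (y : Fin n → G) : ℕ :=
  Nat.card {i : Fin n // y i ∉ S}

section StraightLinePrograms

variable {G : Type*}

open Classical in
theorem reducedLength_eq_sum (S : Set G) {n : ℕ} (y : Fin n → G) :
    reducedLength S y = ∑ i, if y i ∈ S then 0 else 1 := by
  rw [reducedLength, Nat.card_eq_fintype_card, Fintype.card_subtype, Finset.card_filter]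
  exact Finset.sum_congr rfl fun i _ => by split_ifs <;> simp_all

open Classical in
theorem reducedLength_snoc (S : Set G) {n : ℕ} (y : Fin n → G) (a : G) :
    reducedLength S (Fin.snoc y a : Fin (n + 1) → G) =
      reducedLength S y + if a ∈ S then 0 else 1 := by
  simp [reducedLength_eq_sum, Fin.sum_univ_castSucc]

theorem le_two_pow_log₂ (m : ℕ) : m ≤ 2 ^ log₂ m :=
  Nat.sInf_mem (s := {r : ℕ | m ≤ 2 ^ r}) ⟨m, Nat.lt_two_pow_self.le⟩

variable [Group G]

theorem IsSLP.snoc {S : Set G} {n : ℕ} {y : Fin n → G} (hy : IsSLP S y) {a : G}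
    (ha : a ∈ S ∨ (∃ j, a = (y j)⁻¹) ∨ ∃ j k, a = y j * y k) :
    IsSLP S (Fin.snoc y a : Fin (n + 1) → G) := by
  intro i
  induction i using Fin.lastCases with
  | last =>
    rcases ha with ha | ⟨j, rfl⟩ | ⟨j, k, rfl⟩
    · exact .inl (by simpa)
    · exact .inr (.inl ⟨j.castSucc, j.castSucc_lt_last, by simp⟩)
    · exact .inr (.inr ⟨j.castSucc, k.castSucc, j.castSucc_lt_last, k.castSucc_lt_last, by simp⟩)
  | cast i =>
    rcases hy i with h | ⟨j, hj, h⟩ | ⟨j, k, hj, hk, h⟩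
    · exact .inl (by simpa)
    · exact .inr (.inl ⟨j.castSucc, by simpa, by simpa⟩)
    · exact .inr (.inr ⟨j.castSucc, k.castSucc, by simpa, by simpa, by simpa⟩)

/-- `T` is the set of entries of some SLP over `S` of reduced length at most `n`. -/
def IsSLPRange (S : Set G) (n : ℕ) (T : Set G) : Prop :=
  ∃ (m : ℕ) (y : Fin m → G), IsSLP S y ∧ reducedLength S y ≤ n ∧ Set.range y = T

namespace IsSLPRange

variable {S T : Set G} {m n : ℕ} {a b : G}

theorem mono (h : IsSLPRange S m T) (hmn : m ≤ n) : IsSLPRange S n T := by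
  obtain ⟨k, y, hy, hl, rfl⟩ := h
  exact ⟨k, y, hy, hl.trans hmn, rfl⟩

theorem empty (S : Set G) : IsSLPRange S 0 ∅ :=
  ⟨0, Fin.elim0, fun i => i.elim0, by simp [reducedLength], by simp⟩

theorem insert_mem (h : IsSLPRange S n T) (ha : a ∈ S) : IsSLPRange S n (insert a T) := by
  obtain ⟨k, y, hy, hl, rfl⟩ := h
  exact ⟨k + 1, Fin.snoc y a, hy.snoc (.inl ha), by simpa [reducedLength_snoc, ha], by simp⟩

theorem insert_inv (h : IsSLPRange S n T) (ha : a ∈ T) :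
    IsSLPRange S (n + 1) (insert a⁻¹ T) := by
  obtain ⟨k, y, hy, hl, rfl⟩ := h
  obtain ⟨j, rfl⟩ := ha
  refine ⟨k + 1, Fin.snoc y (y j)⁻¹, hy.snoc (.inr (.inl ⟨j, rfl⟩)), ?_, by simp⟩
  rw [reducedLength_snoc]
  split_ifs <;> omega

theorem insert_mul (h : IsSLPRange S n T) (ha : a ∈ T) (hb : b ∈ T) :
    IsSLPRange S (n + 1) (insert (a * b) T) := by
  obtain ⟨l, y, hy, hl, rfl⟩ := h
  obtain ⟨j, rfl⟩ := ha
  obtain ⟨k, rfl⟩ := hb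
  refine ⟨l + 1, Fin.snoc y (y j * y k), hy.snoc (.inr (.inr ⟨j, k, rfl⟩)), ?_, by simp⟩
  rw [reducedLength_snoc]
  split_ifs <;> omega

end IsSLPRange

/-- Every SLP over `S` whose entries include `T` extends to one computing `a`, with at most `c`
further entries outside `S`. -/
def ExtensionCostLE (S T : Set G) (a : G) (c : ℕ) : Prop :=
  ∀ n U, T ⊆ U → IsSLPRange S n U → ∃ V, U ⊆ V ∧ a ∈ V ∧ IsSLPRange S (n + c) V

namespace ExtensionCostLE

variable {S T U : Set G} {a b : G} {c d : ℕ}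

theorem of_mem (ha : a ∈ T) : ExtensionCostLE S T a 0 :=
  fun _ U hU h => ⟨U, subset_rfl, hU ha, h⟩

theorem of_mem_generators (ha : a ∈ S) : ExtensionCostLE S T a 0 :=
  fun _ U _ h => ⟨insert a U, Set.subset_insert _ _, Set.mem_insert _ _, h.insert_mem ha⟩

theorem mono (h : ExtensionCostLE S T a c) (hTU : T ⊆ U) (hcd : c ≤ d) :
    ExtensionCostLE S U a d := fun n W hW hn =>
  let ⟨V, hV, ha, hc⟩ := h n W (hTU.trans hW) hn
  ⟨V, hV, ha, hc.mono (by omega)⟩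

theorem inv (h : ExtensionCostLE S T a c) : ExtensionCostLE S T a⁻¹ (c + 1) := fun n U hU hn =>
  let ⟨V, hV, ha, hc⟩ := h n U hU hn
  ⟨insert a⁻¹ V, hV.trans (Set.subset_insert _ _), Set.mem_insert _ _, hc.insert_inv ha⟩

theorem mul (ha : ExtensionCostLE S T a c) (hb : ExtensionCostLE S T b d) :
    ExtensionCostLE S T (a * b) (c + d + 1) := fun n U hU hn =>
  let ⟨V, hV, haV, hc⟩ := ha n U hU hn
  let ⟨W, hW, hbW, hd⟩ := hb _ V (hU.trans hV) hc
  ⟨insert (a * b) W, (hV.trans hW).trans (Set.subset_insert _ _), Set.mem_insert _ _,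
    (hd.insert_mul (hW haV) hbW).mono (by omega)⟩

end ExtensionCostLE

/-- `K` is a nondegenerate cube of dimension `i` computable from an SLP over `S` with entries `T`:
the state after `i` steps of the doubling process. -/
structure IsReachableCube (S : Set G) (i : ℕ) (T : Set G) (K : Finset G) : Prop where
  isSLPRange : IsSLPRange S (i ^ 2) T
  card_eq : K.card = 2 ^ i
  one_mem : 1 ∈ K
  cost : ∀ k ∈ K, k = 1 ∨ ∃ c < i, ExtensionCostLE S T k c

namespace IsReachableCube

variable {S T : Set G} {i : ℕ} {K : Finset G}

theorem inv_mul_cost (h : IsReachableCube S i T K) {k l : G} (hk : k ∈ K) (hl : l ∈ K) :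
    k⁻¹ * l = 1 ∨ ExtensionCostLE S T (k⁻¹ * l) (2 * i) := by
  rcases h.cost k hk with rfl | ⟨c, hc, hkc⟩ <;> rcases h.cost l hl with rfl | ⟨d, hd, hld⟩
  · simp
  · simpa using .inr (hld.mono subset_rfl (by omega))
  · simpa using .inr (hkc.inv.mono subset_rfl (by omega))
  · exact .inr ((hkc.inv.mul hld).mono subset_rfl (by omega))

/-- A cube `K` for which `K⁻¹ K` is not stable under right multiplication by `S` can be doubled. -/
theorem exists_succ (h : IsReachableCube S i T K) {k l s : G} (hk : k ∈ K) (hl : l ∈ K)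
    (hs : s ∈ S) (hz : ∀ a ∈ K, ∀ b ∈ K, k⁻¹ * l * s ≠ a⁻¹ * b) :
    ∃ T' K', IsReachableCube S (i + 1) T' K' := by
  classical
  set z := k⁻¹ * l * s with hzdef
  have hcost : ExtensionCostLE S T z (2 * i + 1) := by
    rcases h.inv_mul_cost hk hl with h1 | h1
    · rw [hzdef, h1, one_mul]
      exact (ExtensionCostLE.of_mem_generators hs).mono subset_rfl (by omega)
    · exact h1.mul (.of_mem_generators hs)
  obtain ⟨V, hTV, hzV, hV⟩ := hcost _ T subset_rfl h.isSLPRange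
  refine ⟨V, K ∪ K.image (· * z), hV.mono (by ring_nf; rfl), ?_,
    Finset.mem_union_left _ h.one_mem, ?_⟩
  · rw [Finset.card_union_of_disjoint, Finset.card_image_of_injective _ (mul_left_injective z),
      h.card_eq, pow_succ, mul_two]
    rw [Finset.disjoint_left]
    intro b hb hb'
    obtain ⟨a, ha, rfl⟩ := Finset.mem_image.1 hb'
    exact hz a ha _ hb (by simp)
  · intro x hx
    rcases Finset.mem_union.1 hx with hx | hx
    · exact (h.cost x hx).imp_right fun ⟨c, hc, hxc⟩ => ⟨c, by omega, hxc.mono hTV le_rfl⟩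
    · obtain ⟨a, ha, rfl⟩ := Finset.mem_image.1 hx
      right
      rcases h.cost a ha with rfl | ⟨c, hc, hac⟩
      · exact ⟨0, by omega, by simpa using ExtensionCostLE.of_mem hzV⟩
      · exact ⟨c + 1, by omega, (hac.mono hTV le_rfl).mul (.of_mem hzV)⟩

theorem le_log₂ [Finite G] (h : IsReachableCube S i T K) : i ≤ log₂ (Nat.card G) := by
  have := Fintype.ofFinite G
  have hK : 2 ^ i ≤ Nat.card G := by
    rw [← h.card_eq, Nat.card_eq_fintype_card]
    exact K.card_le_univ
  exact (Nat.pow_le_pow_iff_right one_lt_two).1 (hK.trans (le_two_pow_log₂ _))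

end IsReachableCube

theorem exists_isReachableCube_stable [Finite G] (S : Set G) :
    ∃ i T K, IsReachableCube S i T K ∧
      ∀ k ∈ K, ∀ l ∈ K, ∀ s ∈ S, ∃ a ∈ K, ∃ b ∈ K, k⁻¹ * l * s = a⁻¹ * b := by
  by_contra! hne
  have hall : ∀ i, ∃ T K, IsReachableCube S i T K := by
    intro i
    induction i with
    | zero => exact ⟨∅, {1}, .empty S, by simp, by simp, by simp⟩
    | succ i ih =>
      obtain ⟨T, K, h⟩ := ih
      obtain ⟨k, hk, l, hl, s, hs, hz⟩ := hne i T K h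
      exact h.exists_succ hk hl hs hz
  obtain ⟨T, K, h⟩ := hall (log₂ (Nat.card G) + 1)
  exact absurd h.le_log₂ (by omega)

theorem isSLPRange_one_mem [Finite G] {S : Set G} (hS : S.Nonempty) :
    ∃ T, 1 ∈ T ∧ IsSLPRange S ((log₂ (Nat.card G) + 1) ^ 2) T := by
  by_cases h1 : (1 : G) ∈ S
  · exact ⟨_, Set.mem_insert 1 ∅, ((IsSLPRange.empty S).insert_mem h1).mono (by omega)⟩
  obtain ⟨s, hs⟩ := hS
  have hlog : log₂ (Nat.card G) ≠ 0 := fun h0 => by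
    have hcard := le_two_pow_log₂ (Nat.card G)
    rw [h0, pow_zero, Finite.card_le_one_iff_subsingleton] at hcard
    exact h1 (Subsingleton.elim s 1 ▸ hs)
  have hcost : ExtensionCostLE S ∅ (s * s⁻¹) 2 :=
    (ExtensionCostLE.of_mem_generators hs).mul (ExtensionCostLE.of_mem_generators hs).inv
  obtain ⟨T, -, hT, hc⟩ := hcost 0 ∅ subset_rfl (.empty S)
  exact ⟨T, by simpa using hT, hc.mono (by nlinarith [Nat.pos_of_ne_zero hlog])⟩

end StraightLinePrograms

/-- Reachability Lemma. Let `r = log |G|`. For every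
nonempty `S ⊆ G` and every `g ∈ ⟨S⟩` there is an SLP over `S` of reduced
length at most `(r+1)²` computing `g`. -/
theorem reachability_lemma
    {G : Type*} [Group G] [Finite G] (S : Set G) (hS : S.Nonempty)
    (g : G) (hg : g ∈ Subgroup.closure S) :
    ∃ (n : ℕ) (y : Fin n → G), IsSLP S y ∧
      reducedLength S y ≤ (log₂ (Nat.card G) + 1) ^ 2 ∧
      g ∈ Set.range y := by
  suffices h : ∃ T, g ∈ T ∧ IsSLPRange S ((log₂ (Nat.card G) + 1) ^ 2) T by
    obtain ⟨_, hgT, n, y, hy, hl, rfl⟩ := h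
    exact ⟨n, y, hy, hl, hgT⟩
  obtain ⟨i, T, K, h, hstable⟩ := exists_isReachableCube_stable S
  have hmem : ∃ k ∈ K, ∃ l ∈ K, g = k⁻¹ * l := by
    rw [← Subgroup.mem_toSubmonoid, Subgroup.closure_toSubmonoid_of_finite] at hg
    induction hg using Submonoid.closure_induction_right with
    | one => exact ⟨1, h.one_mem, 1, h.one_mem, by simp⟩
    | mul_right x _ s hs ih =>
      obtain ⟨k, hk, l, hl, rfl⟩ := ih
      exact hstable k hk l hl s hs
  obtain ⟨k, hk, l, hl, rfl⟩ := hmem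
  rcases h.inv_mul_cost hk hl with h1 | hcost
  · rw [h1]
    exact isSLPRange_one_mem hS
  · obtain ⟨V, -, hgV, hV⟩ := hcost _ T subset_rfl h.isSLPRange
    exact ⟨V, hgV, hV.mono (by nlinarith [h.le_log₂])⟩
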